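/- (Case IV is impossible) There is no point x* ∈ Δ^7 with F†(x*) = α† such that f_j(x*) = α† for every j ∈ {1,2,3,7,8} and f_j(x*) < α† for every j ∈ {4,5,6}. -/

import Mathlib

noncomputable def sigD (t : ℝ) : ℝ := (1 - t) / t

def DeltaSeven : Set (Fin 8 → ℝ) := {x | (∀ i, 0 < x i) ∧ ∑ i, x i = 1}

noncomputable def fD (x : Fin 8 → ℝ) : Fin 8 → ℝ :=
  ![sigD (x 3 + x 4 + x 5) * sigD (x 0),
    sigD (x 3 + x 4 + x 5 + x 6 + x 7) * sigD (x 1),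
    sigD (x 0 + x 1 + x 2 + x 6 + x 7) * sigD (x 2),
    sigD (x 0 + x 1 + x 2) * sigD (x 3),
    sigD (x 0 + x 1 + x 2 + x 6 + x 7) * sigD (x 4),
    sigD (x 3 + x 4 + x 5 + x 6 + x 7) * sigD (x 5),
    sigD (x 3 + x 4 + x 5) * sigD (x 6),
    sigD (x 0 + x 1 + x 2) * sigD (x 7)]

noncomputable def FD (x : Fin 8 → ℝ) : ℝ :=
  Finset.univ.sup' Finset.univ_nonempty (fD x)

noncomputable def alphaD : ℝ := sInf (FD '' DeltaSeven)

open Filter Topology in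
/-- one constraint along a line, strict or tight with a good derivative -/
lemma sig_ev (α s t s' t' : ℝ) (hα : 1 < α) (hs : 0 < s) (ht : 0 < t) (hs1 : s < 1)
    (h : sigD s * sigD t < α ∨
      (sigD s * sigD t = α ∧ -s' * (α / (α * s + 1 - s) ^ 2) < t')) :
    ∀ᶠ e in 𝓝[>] (0 : ℝ), sigD (s + e * s') * sigD (t + e * t') < α := by
  have c1 : Tendsto (fun e : ℝ => s + e * s') (𝓝[>] 0) (𝓝 s) := by
    have : Continuous (fun e : ℝ => s + e * s') := by fun_prop
    have := this.tendsto 0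
    simp only [zero_mul, add_zero] at this
    exact this.mono_left nhdsWithin_le_nhds
  have c2 : Tendsto (fun e : ℝ => t + e * t') (𝓝[>] 0) (𝓝 t) := by
    have : Continuous (fun e : ℝ => t + e * t') := by fun_prop
    have := this.tendsto 0
    simp only [zero_mul, add_zero] at this
    exact this.mono_left nhdsWithin_le_nhds
  rcases h with h | ⟨h, hd⟩
  · have c3 : Tendsto (fun e : ℝ => sigD (s + e * s') * sigD (t + e * t')) (𝓝[>] 0)
        (𝓝 (sigD s * sigD t)) := by
      unfold sigD
      exact ((tendsto_const_nhds.sub c1).div c1 hs.ne').mul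
        ((tendsto_const_nhds.sub c2).div c2 ht.ne')
    exact c3.eventually_lt_const h
  · have hM : 0 < α * s + 1 - s := by nlinarith
    have hK : (1 - s) * (1 - t) = α * s * t := by
      unfold sigD at h
      field_simp at h
      linarith
    have hN : (α * t + 1 - t) * (α * s + 1 - s) = α := by linear_combination (1-α) * hK
    have hlin : 0 < (α * t + 1 - t) * s' + (α * s + 1 - s) * t' := by
      have e1 : α * t + 1 - t = α / (α * s + 1 - s) := by
        rw [eq_div_iff hM.ne']; exact hN
      have := mul_lt_mul_of_pos_left hd hM
      have e2 : (α * s + 1 - s) * (-s' * (α / (α * s + 1 - s) ^ 2))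
          = - (s' * (α / (α * s + 1 - s))) := by
        field_simp
      rw [e2] at this
      rw [e1]; linarith
    have c4 : Tendsto (fun e : ℝ => (α * t + 1 - t) * s' + (α * s + 1 - s) * t'
        + e * ((α - 1) * s' * t')) (𝓝[>] 0)
        (𝓝 ((α * t + 1 - t) * s' + (α * s + 1 - s) * t')) := by
      have : Continuous (fun e : ℝ => (α * t + 1 - t) * s' + (α * s + 1 - s) * t'
        + e * ((α - 1) * s' * t')) := by fun_prop
      have := this.tendsto 0
      simp only [zero_mul, add_zero] at this
      exact this.mono_left nhdsWithin_le_nhds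
    filter_upwards [c1.eventually_const_lt hs, c2.eventually_const_lt ht,
      c4.eventually_const_lt hlin, self_mem_nhdsWithin] with e h1 h2 h3 h4
    have h4' : 0 < e := h4
    unfold sigD
    rw [div_mul_div_comm, div_lt_iff₀ (mul_pos h1 h2)]
    nlinarith [mul_pos h4' h3]

/-- existence of a good direction in the `(A,B)` plane -/
lemma good_dir (α A B : ℝ) (hα : 1 < α) (hA : 0 < A) (hB : 0 < B) (hAB : A + B < 1)
    (h : A + (1 - A) / (α * A + 1 - A) < B + (1 - B) / (α * B + 1 - B)) :
    ∃ u v : ℝ,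
      0 < (1 - α / (α * (1 - A) + 1 - (1 - A)) ^ 2) * u
        + (α / (α * B + 1 - B) ^ 2 - α / (α * (1 - B) + 1 - (1 - B)) ^ 2) * v ∧
      0 < (α / (α * A + 1 - A) ^ 2 - 1) * u + (α / (α * B + 1 - B) ^ 2 - 1) * v := by
  obtain ⟨a, ha⟩ : ∃ a, a = α * A + 1 - A := ⟨_, rfl⟩
  obtain ⟨b, hb⟩ : ∃ b, b = α * B + 1 - B := ⟨_, rfl⟩
  obtain ⟨c, hc⟩ : ∃ c, c = α * (1 - A) + 1 - (1 - A) := ⟨_, rfl⟩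
  obtain ⟨d, hd⟩ : ∃ d, d = α * (1 - B) + 1 - (1 - B) := ⟨_, rfl⟩
  rw [← ha, ← hb] at h
  rw [← ha, ← hb, ← hc, ← hd]
  have a0 : 0 < a := by nlinarith
  have b0 : 0 < b := by nlinarith
  have c0 : 0 < c := by nlinarith
  have d0 : 0 < d := by nlinarith
  have hac : a + c = 1 + α := by rw [ha, hc]; ring
  have hbd : b + d = 1 + α := by rw [hb, hd]; ring
  have hprod : 0 < (B - A) * (a * b - α) := by
    have e : (B + (1 - B) / b) - (A + (1 - A) / a) = (B - A) * (a * b - α) / (a * b) := by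
      field_simp
      rw [ha, hb]; ring
    have : 0 < (B - A) * (a * b - α) / (a * b) := by rw [← e]; linarith
    exact (div_pos_iff_of_pos_right (mul_pos a0 b0)).1 this
  by_cases hp : b ^ 2 < α
  · refine ⟨0, 1, ?_, ?_⟩
    · have : b < d := by nlinarith [sq_nonneg (α - 1)]
      have : α / d ^ 2 < α / b ^ 2 := by gcongr
      linarith
    · have : 1 < α / b ^ 2 := by rw [lt_div_iff₀ (by positivity)]; linarith
      linarith
  · push Not at hp
    have hlt : A < B := by
      by_contra hcon
      push Not at hcon
      have : b ≤ a := by nlinarith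
      have h2 : α ≤ a * b := by nlinarith
      have := mul_nonneg (sub_nonneg.2 hcon) (sub_nonneg.2 h2)
      linarith
    have hab : a < b := by nlinarith
    have hdc : d < c := by linarith
    have hcα : α < c ^ 2 := by
      have : a < c := by nlinarith
      nlinarith [sq_nonneg (α - 1)]
    have hr : α / c ^ 2 < 1 := by rw [div_lt_one (by positivity)]; exact hcα
    by_cases hq : a ^ 2 < α
    · refine ⟨1, 0, by linarith, ?_⟩
      have : 1 < α / a ^ 2 := by rw [lt_div_iff₀ (by positivity)]; linarith
      linarith
    · push Not at hq
      have hq1 : α / a ^ 2 ≤ 1 := by rw [div_le_one (by positivity)]; exact hq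
      have hpq : α / b ^ 2 < α / a ^ 2 := by gcongr
      have hrs : α / c ^ 2 < α / d ^ 2 := by gcongr
      generalize α / a ^ 2 = q at *
      generalize α / b ^ 2 = p at *
      generalize α / c ^ 2 = r at *
      generalize α / d ^ 2 = s at *
      have hdet : 0 < (1 - r) * (1 - p) - (p - s) * (1 - q) := by
        rcases le_or_gt s 1 with hs | hs
        · nlinarith [mul_pos (sub_pos.2 hrs) (sub_pos.2 (hpq.trans_le hq1)),
            mul_nonneg (sub_nonneg.2 hs) (sub_pos.2 hpq).le,
            mul_nonneg (sub_nonneg.2 hq1) (sub_pos.2 (hpq.trans_le hq1)).le]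
        · nlinarith [mul_pos (sub_pos.2 hr) (sub_pos.2 (hpq.trans_le hq1)),
            mul_nonneg (sub_nonneg.2 hq1) (sub_pos.2 hs).le,
            mul_nonneg (sub_nonneg.2 hq1) (sub_pos.2 (hpq.trans_le hq1)).le]
      generalize hD : (1 - r) * (1 - p) - (p - s) * (1 - q) = D at *
      have hk : 0 < |p - s| + 1 := by positivity
      refine ⟨1 - p, -(1 - q) - D / (|p - s| + 1), ?_, ?_⟩
      · have h1 : (p - s) * (D / (|p - s| + 1)) < D := by
          rw [← mul_div_assoc, div_lt_iff₀ hk]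
          nlinarith [le_abs_self (p - s)]
        linear_combination h1 - hD
      · have : 0 < (1 - p) * (D / (|p - s| + 1)) :=
          mul_pos (by linarith) (div_pos hdet hk)
        linear_combination this

/-- `t` solved from a tight constraint -/
lemma sig_solve (α s t : ℝ) (hα : 1 < α) (hs : 0 < s) (ht : 0 < t)
    (h : sigD s * sigD t = α) : t = (1 - s) / (α * s + 1 - s) := by
  have hM : 0 < α * s + 1 - s := by nlinarith
  rw [eq_div_iff hM.ne']
  unfold sigD at h
  field_simp at h
  linarith

lemma sig_lt (s t t' : ℝ) (hs : 0 < s) (hs1 : s < 1) (ht : 0 < t) (ht' : 0 < t')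
    (h : sigD s * sigD t < sigD s * sigD t') : t' < t := by
  have h0 : 0 < sigD s := div_pos (by linarith) hs
  have h1 := lt_of_mul_lt_mul_left h h0.le
  unfold sigD at h1
  rw [div_lt_div_iff₀ ht ht'] at h1
  linarith

open Filter Topology in
theorem stmt10 :
    ¬ ∃ x ∈ DeltaSeven, FD x = alphaD ∧
      fD x 0 = alphaD ∧ fD x 1 = alphaD ∧ fD x 2 = alphaD ∧
      fD x 6 = alphaD ∧ fD x 7 = alphaD ∧
      fD x 3 < alphaD ∧ fD x 4 < alphaD ∧ fD x 5 < alphaD := by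
  rintro ⟨x, ⟨hpos, hsum⟩, -, h0, h1, h2, h6, h7, h3, h4, h5⟩
  have key : ∀ y ∈ DeltaSeven, ∃ i, alphaD ≤ fD y i := by
    intro y hy
    have hbdd : BddBelow (FD '' DeltaSeven) := by
      refine ⟨0, ?_⟩
      rintro _ ⟨z, ⟨hz, hzs⟩, rfl⟩
      have : fD z 0 ≤ FD z := Finset.le_sup' (fD z) (Finset.mem_univ 0)
      refine le_trans ?_ this
      simp only [Fin.sum_univ_eight] at hzs
      have := hz 0; have := hz 1; have := hz 2; have := hz 3
      have := hz 4; have := hz 5; have := hz 6; have := hz 7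
      change 0 ≤ sigD (z 3 + z 4 + z 5) * sigD (z 0)
      exact mul_nonneg (div_nonneg (by linarith) (by linarith))
        (div_nonneg (by linarith) (by linarith))
    have h : alphaD ≤ FD y := csInf_le hbdd ⟨y, hy, rfl⟩
    unfold FD at h
    rw [Finset.le_sup'_iff] at h
    obtain ⟨i, -, hi⟩ := h
    exact ⟨i, hi⟩
  generalize alphaD = α at *
  simp only [Fin.sum_univ_eight] at hsum
  have p0 := hpos 0
  have p1 := hpos 1
  have p2 := hpos 2
  have p3 := hpos 3
  have p4 := hpos 4
  have p5 := hpos 5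
  have p6 := hpos 6
  have p7 := hpos 7
  change sigD (x 3 + x 4 + x 5) * sigD (x 0) = α at h0
  change sigD (x 3 + x 4 + x 5 + x 6 + x 7) * sigD (x 1) = α at h1
  change sigD (x 0 + x 1 + x 2 + x 6 + x 7) * sigD (x 2) = α at h2
  change sigD (x 0 + x 1 + x 2) * sigD (x 3) < α at h3
  change sigD (x 0 + x 1 + x 2 + x 6 + x 7) * sigD (x 4) < α at h4
  change sigD (x 3 + x 4 + x 5 + x 6 + x 7) * sigD (x 5) < α at h5
  change sigD (x 3 + x 4 + x 5) * sigD (x 6) = α at h6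
  change sigD (x 0 + x 1 + x 2) * sigD (x 7) = α at h7
  obtain ⟨A, hA⟩ : ∃ A, A = x 0 + x 1 + x 2 := ⟨_, rfl⟩
  obtain ⟨B, hB⟩ : ∃ B, B = x 3 + x 4 + x 5 := ⟨_, rfl⟩
  have eA : x 3 + x 4 + x 5 + x 6 + x 7 = 1 - A := by linarith
  have eB : x 0 + x 1 + x 2 + x 6 + x 7 = 1 - B := by linarith
  rw [← hB] at h0 h6
  rw [← hA] at h3 h7
  rw [eA] at h1 h5
  rw [eB] at h2 h4
  have A0 : 0 < A := by linarith
  have B0 : 0 < B := by linarith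
  have AB : A + B < 1 := by linarith
  have hα : 1 < α := by
    rw [← h0]
    unfold sigD
    rw [div_mul_div_comm, lt_div_iff₀ (by positivity)]
    nlinarith
  have s0 := sig_solve α B (x 0) hα B0 p0 h0
  have s7 := sig_solve α A (x 7) hα A0 p7 h7
  have l3 := sig_lt A (x 3) (x 7) A0 (by linarith) p3 p7 (by rw [h7]; exact h3)
  have l4 := sig_lt (1 - B) (x 4) (x 2) (by linarith) (by linarith) p4 p2 (by rw [h2]; exact h4)
  have l5 := sig_lt (1 - A) (x 5) (x 1) (by linarith) (by linarith) p5 p1 (by rw [h1]; exact h5)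
  obtain ⟨u, v, g1, g3⟩ := good_dir α A B hα A0 B0 AB (by rw [← s0, ← s7]; linarith)
  obtain ⟨p, hp⟩ : ∃ p, p = α / (α * B + 1 - B) ^ 2 := ⟨_, rfl⟩
  obtain ⟨q, hq⟩ : ∃ q, q = α / (α * A + 1 - A) ^ 2 := ⟨_, rfl⟩
  obtain ⟨r, hr⟩ : ∃ r, r = α / (α * (1 - A) + 1 - (1 - A)) ^ 2 := ⟨_, rfl⟩
  obtain ⟨s, hs⟩ : ∃ s, s = α / (α * (1 - B) + 1 - (1 - B)) ^ 2 := ⟨_, rfl⟩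
  rw [← hp, ← hr, ← hs] at g1
  rw [← hp, ← hq] at g3
  obtain ⟨G, hG⟩ : ∃ G, G = ((1 - r) * u + (p - s) * v) / 3 := ⟨_, rfl⟩
  obtain ⟨H, hH⟩ : ∃ H, H = ((q - 1) * u + (p - 1) * v) / 2 := ⟨_, rfl⟩
  have G0 : 0 < G := by rw [hG]; linarith
  have H0 : 0 < H := by rw [hH]; linarith
  have A1 : A < 1 := by linarith
  have B1 : B < 1 := by linarith
  have A2 : 0 < 1 - A := by linarith
  have B2 : 0 < 1 - B := by linarith
  have A3 : 1 - A < 1 := by linarith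
  have B3 : 1 - B < 1 := by linarith
  have E0 := sig_ev α B (x 0) v (-v * p + G) hα B0 p0 B1 (Or.inr ⟨h0, by rw [← hp]; linarith⟩)
  have E1 := sig_ev α (1 - A) (x 1) (-u) (u * r + G) hα A2 p1 A3
    (Or.inr ⟨h1, by rw [← hr]; linarith⟩)
  have E2 := sig_ev α (1 - B) (x 2) (-v) (v * s + G) hα B2 p2 B3
    (Or.inr ⟨h2, by rw [← hs]; linarith⟩)
  have E3 := sig_ev α A (x 3) u (v / 3) hα A0 p3 A1 (Or.inl h3)
  have E4 := sig_ev α (1 - B) (x 4) (-v) (v / 3) hα B2 p4 B3 (Or.inl h4)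
  have E5 := sig_ev α (1 - A) (x 5) (-u) (v / 3) hα A2 p5 A3 (Or.inl h5)
  have E6 := sig_ev α B (x 6) v (-v * p + H) hα B0 p6 B1 (Or.inr ⟨h6, by rw [← hp]; linarith⟩)
  have E7 := sig_ev α A (x 7) u (-u * q + H) hα A0 p7 A1 (Or.inr ⟨h7, by rw [← hq]; linarith⟩)
  obtain ⟨w, hw⟩ : ∃ w : Fin 8 → ℝ, w = ![-v * p + G, u * r + G, v * s + G, v / 3, v / 3, v / 3,
    -v * p + H, -u * q + H] := ⟨_, rfl⟩
  have w0 : w 0 = -v * p + G := by rw [hw]; rfl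
  have w1 : w 1 = u * r + G := by rw [hw]; rfl
  have w2 : w 2 = v * s + G := by rw [hw]; rfl
  have w3 : w 3 = v / 3 := by rw [hw]; rfl
  have w4 : w 4 = v / 3 := by rw [hw]; rfl
  have w5 : w 5 = v / 3 := by rw [hw]; rfl
  have w6 : w 6 = -v * p + H := by rw [hw]; rfl
  have w7 : w 7 = -u * q + H := by rw [hw]; rfl
  have EP : ∀ᶠ e in 𝓝[>] (0 : ℝ), ∀ i, 0 < x i + e * w i := by
    rw [eventually_all]
    intro i
    have : Continuous (fun e : ℝ => x i + e * w i) := by fun_prop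
    have := this.tendsto 0
    simp only [zero_mul, add_zero] at this
    exact (this.mono_left nhdsWithin_le_nhds).eventually_const_lt (hpos i)
  obtain ⟨e, F0, F1, F2, F3, F4, F5, F6, F7, FP⟩ := (E0.and (E1.and (E2.and (E3.and (E4.and
    (E5.and (E6.and (E7.and EP)))))))).exists
  have wA : w 0 + w 1 + w 2 = u := by rw [w0, w1, w2, hG]; ring
  have wB : w 3 + w 4 + w 5 = v := by rw [w3, w4, w5]; ring
  have wC : w 6 + w 7 = -u - v := by rw [w6, w7, hH]; ring
  obtain ⟨i, hi⟩ := key (fun i => x i + e * w i) ⟨FP, by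
    simp only [Fin.sum_univ_eight]
    linear_combination hsum + e * wA + e * wB + e * wC⟩
  have zB : (x 3 + e * w 3) + (x 4 + e * w 4) + (x 5 + e * w 5) = B + e * v := by
    linear_combination e * wB - hB
  have zA : (x 0 + e * w 0) + (x 1 + e * w 1) + (x 2 + e * w 2) = A + e * u := by
    linear_combination e * wA - hA
  have zA' : (x 3 + e * w 3) + (x 4 + e * w 4) + (x 5 + e * w 5) + (x 6 + e * w 6)
      + (x 7 + e * w 7) = 1 - A + e * -u := by
    linear_combination e * wB + e * wC + eA
  have zB' : (x 0 + e * w 0) + (x 1 + e * w 1) + (x 2 + e * w 2) + (x 6 + e * w 6)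
      + (x 7 + e * w 7) = 1 - B + e * -v := by
    linear_combination e * wA + e * wC + eB
  refine absurd hi (not_le.2 ?_)
  fin_cases i
  · change sigD ((x 3 + e * w 3) + (x 4 + e * w 4) + (x 5 + e * w 5)) * sigD (x 0 + e * w 0) < α
    rw [zB, w0]; exact F0
  · change sigD ((x 3 + e * w 3) + (x 4 + e * w 4) + (x 5 + e * w 5) + (x 6 + e * w 6)
      + (x 7 + e * w 7)) * sigD (x 1 + e * w 1) < α
    rw [zA', w1]; exact F1
  · change sigD ((x 0 + e * w 0) + (x 1 + e * w 1) + (x 2 + e * w 2) + (x 6 + e * w 6)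
      + (x 7 + e * w 7)) * sigD (x 2 + e * w 2) < α
    rw [zB', w2]; exact F2
  · change sigD ((x 0 + e * w 0) + (x 1 + e * w 1) + (x 2 + e * w 2)) * sigD (x 3 + e * w 3) < α
    rw [zA, w3]; exact F3
  · change sigD ((x 0 + e * w 0) + (x 1 + e * w 1) + (x 2 + e * w 2) + (x 6 + e * w 6)
      + (x 7 + e * w 7)) * sigD (x 4 + e * w 4) < α
    rw [zB', w4]; exact F4
  · change sigD ((x 3 + e * w 3) + (x 4 + e * w 4) + (x 5 + e * w 5) + (x 6 + e * w 6)
      + (x 7 + e * w 7)) * sigD (x 5 + e * w 5) < α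
    rw [zA', w5]; exact F5
  · change sigD ((x 3 + e * w 3) + (x 4 + e * w 4) + (x 5 + e * w 5)) * sigD (x 6 + e * w 6) < α
    rw [zB, w6]; exact F6
  · change sigD ((x 0 + e * w 0) + (x 1 + e * w 1) + (x 2 + e * w 2)) * sigD (x 7 + e * w 7) < α
    rw [zA, w7]; exact F7
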